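/- arXiv:2003.02246 — 4 statements merged into one kernel-verified Lean document; each statement's English description precedes it below -/
import Mathlib

section
/- Let q = 2^n be even and let r ∈ F_{q^2} with r ∉ F_q. The map from F_q to F_{q^2} sending x to x + 1/(x − r) + 1/(x − r^q) is injective if and only if r + r^q = 1. -/
open Polynomial in
theorem FiniteField.splits_X_pow_card_sub_X_self (F : Type*) [Field F] [Fintype F] :
    (X ^ Fintype.card F - X : F[X]).Splits := by
  rw [splits_iff_card_roots, FiniteField.roots_X_pow_card_sub_X,
    FiniteField.X_pow_card_sub_X_natDegree_eq _ Fintype.one_lt_card]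
  rfl

open Polynomial in
/-- Over an extension `K` of a finite field `F`, the logarithmic derivative of `X ^ #F - X`
gives the sum of the reciprocals of the translates of an element by `F`. -/
theorem sum_inv_sub_algebraMap {F K : Type*} [Field F] [Fintype F] [Field K] [Algebra F K]
    {y : K} (hy : y ^ Fintype.card F - y ≠ 0) :
    ∑ a : F, (y - algebraMap F K a)⁻¹ = -(y ^ Fintype.card F - y)⁻¹ := by
  have hs := FiniteField.splits_X_pow_card_sub_X_self F
  have hr := hs.roots_map (algebraMap F K)
  have hd := (hs.map (algebraMap F K)).eval_derivative_div_eval_of_ne_zero (x := y)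
    (by simpa using hy)
  have hc : (Fintype.card F : K) = 0 := by
    rw [← map_natCast (algebraMap F K), FiniteField.cast_card_eq_zero, map_zero]
  rw [hr, FiniteField.roots_X_pow_card_sub_X, Multiset.map_map] at hd
  simpa [hc, derivative_X_pow, neg_div, -neg_sub] using hd.symm

open Polynomial in
/-- The elements of an extension of a finite field `F` fixed by the `#F`-power map lie in `F`. -/
theorem mem_range_algebraMap_of_pow_card {F K : Type*} [Field F] [Fintype F] [Field K]
    [Algebra F K] {y : K} (hy : y ^ Fintype.card F = y) : y ∈ Set.range (algebraMap F K) := by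
  have h0 := FiniteField.X_pow_card_sub_X_ne_zero F (Fintype.one_lt_card (α := F))
  have hy' : y ∈ ((X ^ Fintype.card F - X : F[X]).map (algebraMap F K)).roots := by
    rw [mem_roots (map_ne_zero h0)]
    simp [hy]
  rw [(FiniteField.splits_X_pow_card_sub_X_self F).roots_map, Multiset.mem_map] at hy'
  obtain ⟨a, -, ha⟩ := hy'
  exact ⟨a, ha⟩

/-- In characteristic two, a solution of the collision equation with `x ≠ y` splits the
Artin–Schreier polynomial `X ^ 2 + X + c`. -/
theorem exists_sq_add_self_eq_of_mul_eq {F : Type*} [Field F] [CharP F 2] {c x y : F}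
    (hxy : x ≠ y) (h : (x ^ 2 + x + c) * (y ^ 2 + y + c) = x + y + 1) :
    ∃ z, z ^ 2 + z = c := by
  have h2 : (2 : F) = 0 := CharTwo.two_eq_zero
  obtain ⟨u, rfl⟩ : ∃ u, y = x + u := ⟨y - x, by ring⟩
  have hu : u ≠ 0 := by rintro rfl; simp at hxy
  by_cases hu1 : u + 1 = 0
  · refine ⟨x, ?_⟩
    have : (x ^ 2 + x + c) ^ 2 = 0 := by grind
    grind
  obtain ⟨D, hD⟩ : ∃ D, x ^ 2 + x + c = u * (u + 1) * D + (u + 1) :=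
    ⟨(x ^ 2 + x + c - (u + 1)) / (u * (u + 1)), by field_simp; ring⟩
  have hDu : (u + 1) * (D ^ 2 + D) = 1 := by
    have : u ^ 2 * (u + 1) * ((u + 1) * (D ^ 2 + D) - 1) = 0 := by grind
    grind
  have hD1 : D + 1 ≠ 0 := by grind
  refine ⟨x + (D + 1)⁻¹, ?_⟩
  grind

/-- For `q = 2^n` even and `r ∈ F_{q²} \ F_q`, the map
`x ↦ x + 1/(x - r) + 1/(x - r^q)` is injective on `F_q` iff `r + r^q = 1`. -/
theorem stmt_2 (n : ℕ) (hn : 1 ≤ n) (q : ℕ) (hq : q = 2 ^ n)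
    (F K : Type*) [Field F] [Fintype F] [Field K] [Fintype K] [Algebra F K]
    (hF : Fintype.card F = q) (hK : Fintype.card K = q ^ 2)
    (r : K) (hr : r ∉ Set.range (algebraMap F K)) :
    (Function.Injective fun x : F =>
      algebraMap F K x + (algebraMap F K x - r)⁻¹ + (algebraMap F K x - r ^ q)⁻¹)
    ↔ r + r ^ q = 1 := by
  have : Fact (Nat.Prime 2) := ⟨Nat.prime_two⟩
  have : CharP F 2 := charP_of_card_eq_prime_pow (f := n) (by rw [hF, hq])
  have : CharP K 2 := charP_of_injective_algebraMap (algebraMap F K).injective 2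
  have h2 : (2 : K) = 0 := CharTwo.two_eq_zero
  have hfix (x : F) : algebraMap F K x ^ q = algebraMap F K x := by
    rw [← map_pow, ← hF, FiniteField.pow_card]
  have hadd (a b : K) : (a + b) ^ q = a ^ q + b ^ q := by
    rw [hq]; exact add_pow_char_pow a b ..
  have hsub (a b : K) : (a - b) ^ q = a ^ q - b ^ q := by
    rw [hq]; exact sub_pow_char_pow a b n
  have hrq : r ^ q ≠ r := fun h =>
    hr (mem_range_algebraMap_of_pow_card (by rwa [hF]))
  have hrqq : (r ^ q) ^ q = r := by
    rw [← pow_mul, ← sq, ← hK, FiniteField.pow_card]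
  have hne (x : F) : algebraMap F K x - r ≠ 0 := fun h => hr ⟨x, sub_eq_zero.1 h⟩
  have hne' (x : F) : algebraMap F K x - r ^ q ≠ 0 := fun h => by
    apply hne x
    rw [← hfix x, ← hrqq, ← hsub, h, zero_pow (by rw [hq]; positivity)]
  have ht : r + r ^ q ≠ 0 := by grind
  constructor
  · intro hinj
    have hmem (x : F) : ∃ y : F, algebraMap F K y =
        algebraMap F K x + (algebraMap F K x - r)⁻¹ + (algebraMap F K x - r ^ q)⁻¹ := by
      refine mem_range_algebraMap_of_pow_card ?_
      rw [hF]
      simp only [hadd, inv_pow, hsub, hfix, hrqq]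
      ring
    choose σ hσ using hmem
    have hσinj : Function.Injective σ := fun x y h => hinj (by simp only [← hσ, h])
    have hcube : ∑ x : F, algebraMap F K (σ x) ^ 3 = ∑ x : F, algebraMap F K x ^ 3 :=
      (Finite.injective_iff_bijective.1 hσinj).sum_comp fun x => algebraMap F K x ^ 3
    obtain ⟨t, hT⟩ : r + r ^ q ∈ Set.range (algebraMap F K) :=
      mem_range_algebraMap_of_pow_card (by rw [hF, hadd, hrqq, add_comm])
    have hswap (k : ℕ) : ∑ x : F, (algebraMap F K x - r ^ q)⁻¹ ^ k =
        ∑ x : F, (algebraMap F K x - r)⁻¹ ^ k := by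
      rw [← Equiv.sum_comp (Equiv.addRight t)]
      refine Finset.sum_congr rfl fun x _ => ?_
      congr 2
      rw [Equiv.coe_addRight, map_add, hT]
      grind
    have hsum1 : ∑ x : F, (algebraMap F K x - r)⁻¹ = (r + r ^ q)⁻¹ := by
      have := sum_inv_sub_algebraMap (F := F) (y := r) (by rwa [hF, sub_ne_zero])
      rw [hF] at this
      simp only [CharTwo.sub_eq_add, CharTwo.neg_eq] at this ⊢
      rw [add_comm r, ← this]
      exact Finset.sum_congr rfl fun x _ => by rw [add_comm]
    have hsum2 : ∑ x : F, (algebraMap F K x - r)⁻¹ ^ 2 = (r + r ^ q)⁻¹ ^ 2 := by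
      rw [← hsum1, sum_pow_char]
    have hsum1' := hswap 1
    simp only [pow_one] at hsum1'
    have hcard : (q : K) = 0 := by
      rw [← hF, ← map_natCast (algebraMap F K), FiniteField.cast_card_eq_zero, map_zero]
    have hpt (x : F) : algebraMap F K (σ x) ^ 3 - algebraMap F K x ^ 3 =
        (r + r ^ q) + (r ^ 2 + 1) * (algebraMap F K x - r)⁻¹
          + ((r ^ q) ^ 2 + 1) * (algebraMap F K x - r ^ q)⁻¹
          + (r + (r + r ^ q)⁻¹) * (algebraMap F K x - r)⁻¹ ^ 2
          + (r ^ q + (r + r ^ q)⁻¹) * (algebraMap F K x - r ^ q)⁻¹ ^ 2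
          + (algebraMap F K x - r)⁻¹ ^ 3 + (algebraMap F K x - r ^ q)⁻¹ ^ 3 := by
      rw [hσ]
      have h1 := mul_inv_cancel₀ (hne x)
      have h1' := mul_inv_cancel₀ (hne' x)
      have h3 := mul_inv_cancel₀ ht
      generalize (algebraMap F K x - r)⁻¹ = g at *
      generalize (algebraMap F K x - r ^ q)⁻¹ = h at *
      generalize (r + r ^ q)⁻¹ = s at *
      generalize r ^ q = r' at *
      generalize algebraMap F K x = X at *
      have hgh : g * h = (g + h) * s := by grind
      grind
    have key := Finset.sum_congr (rfl : (Finset.univ : Finset F) = _) fun x _ => hpt x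
    rw [Finset.sum_sub_distrib, hcube, sub_self] at key
    simp only [Finset.sum_add_distrib, ← Finset.mul_sum, hswap, hsum1', hsum1, hsum2,
      Finset.sum_const, Finset.card_univ, hF, nsmul_eq_mul, hcard] at key
    have h3 := mul_inv_cancel₀ ht
    generalize (r + r ^ q)⁻¹ = s at *
    generalize r ^ q = r' at *
    have : (r + r' + 1) ^ 2 = 0 := by grind
    grind
  · intro ht1 x y hxy
    by_contra hne2
    have hr1 : r ^ q = r + 1 := by grind
    obtain ⟨c, hc⟩ : r ^ 2 + r ∈ Set.range (algebraMap F K) := by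
      refine mem_range_algebraMap_of_pow_card ?_
      rw [hF, hadd, ← pow_mul, mul_comm, pow_mul, hr1]
      grind
    have hcol : (x ^ 2 + x + c) * (y ^ 2 + y + c) = x + y + 1 := by
      apply (algebraMap F K).injective
      have hxyK : algebraMap F K x - algebraMap F K y ≠ 0 := by
        rw [sub_ne_zero]; exact (algebraMap F K).injective.ne hne2
      simp only [map_mul, map_add, map_pow, map_one, hc]
      have hx := hne x
      have hx' := hne' x
      have hy := hne y
      have hy' := hne' y
      simp only [hr1] at hxy hx hx' hy hy'
      generalize algebraMap F K x = X at *
      generalize algebraMap F K y = Y at *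
      have h := mul_left_cancel₀ hxyK (a := X - Y)
        (b := (X - r) * (X - (r + 1)) * ((Y - r) * (Y - (r + 1)))) (c := X + Y + 1) (by
          field_simp at hxy
          grind)
      grind
    obtain ⟨z, hz⟩ := exists_sq_add_self_eq_of_mul_eq hne2 hcol
    have hzK : algebraMap F K z ^ 2 + algebraMap F K z = r ^ 2 + r := by
      rw [← hc, ← hz, map_add, map_pow]
    have : (algebraMap F K z - r) * (algebraMap F K (z + 1) - r) = 0 := by
      rw [map_add, map_one]
      grind
    exact (mul_ne_zero (hne z) (hne (z + 1))) this
end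

section
/- Let q = 3^n with n ≥ 3, let a ∈ F_q with a ≠ 0, let b ∈ F_q, and let r ∈ F_{q^2} with r ∉ F_q and r^2 ∈ F_q. Then the map from F_q to F_{q^2} sending x to a·x^2 + b·x + 1/(x − r) + 1/(x + r) is not injective. -/
open Finset

section PowerSums

variable {F K : Type*} [Field F] [Fintype F] [Field K] [Algebra F K]

/-- Power sums of small degree over a finite field vanish, also after scaling in an extension. -/
lemma sum_algebraMap_div_pow (r : K) (i : ℕ) (hi : i < Fintype.card F - 1) :
    ∑ x : F, (algebraMap F K x / r) ^ i = 0 := by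
  simp only [div_pow, ← Finset.sum_div, ← map_pow, ← map_sum,
    FiniteField.sum_pow_lt_card_sub_one F i hi, map_zero, zero_div]

lemma algebraMap_div_pow_card {r : K} (hr : r ^ Fintype.card F = -r) (x : F) :
    (algebraMap F K x / r) ^ Fintype.card F = -(algebraMap F K x / r) := by
  rw [div_pow, hr, ← map_pow, FiniteField.pow_card, div_neg]

lemma sum_sub_one_pow (r : K) (m : ℕ) (hm : m < Fintype.card F) :
    ∑ x : F, (algebraMap F K x / r - 1) ^ m = ∑ x : F, (algebraMap F K x / r) ^ m := by
  simp only [sub_eq_add_neg _ (1 : K), add_pow]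
  rw [Finset.sum_comm, Finset.sum_range_succ, Finset.sum_eq_zero]
  · simp
  · intro i hi
    have := Finset.mem_range.1 hi
    rw [← Finset.sum_mul, ← Finset.sum_mul, sum_algebraMap_div_pow r i (by omega)]
    simp

lemma sum_algebraMap_div_pow_card_sub_one {r : K} (hr0 : r ≠ 0)
    (hr : r ^ Fintype.card F = -r) :
    ∑ x : F, (algebraMap F K x / r) ^ (Fintype.card F - 1) = 1 := by
  classical
  have hq : 1 < Fintype.card F := Fintype.one_lt_card
  have hr' : r ^ (Fintype.card F - 1) = -1 := by
    apply mul_right_cancel₀ hr0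
    rw [← pow_succ, Nat.sub_add_cancel hq.le, hr]
    ring
  have key (x : F) : (algebraMap F K x / r) ^ (Fintype.card F - 1) =
      (if x = 0 then 1 else 0) - 1 := by
    split_ifs with hx
    · subst hx
      rw [map_zero, zero_div, zero_pow (by omega)]
      ring
    · rw [div_pow, hr', ← map_pow, FiniteField.pow_card_sub_one_eq_one x hx]
      simp
  have hc : ((Fintype.card F : ℕ) : K) = 0 := by
    rw [← map_natCast (algebraMap F K), FiniteField.cast_card_eq_zero, map_zero]
  simp [key, Finset.sum_sub_distrib, hc]

lemma algebraMap_div_sub_one_ne_zero [CharP K 3] {r : K}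
    (hr : r ^ Fintype.card F = -r) (x : F) : algebraMap F K x / r - 1 ≠ 0 := by
  intro h
  have h3 : (3 : K) = 0 := by exact_mod_cast CharP.cast_eq_zero K 3
  have h1 := algebraMap_div_pow_card hr x
  rw [sub_eq_zero.1 h, one_pow] at h1
  exact one_ne_zero (α := K) (by linear_combination h3 - h1)

lemma sum_inv_sub_one_pow [CharP K 3] {n : ℕ} (hn : Fintype.card F = 3 ^ n) {r : K}
    (hr0 : r ≠ 0) (hr : r ^ Fintype.card F = -r) (j : ℕ) (hj : j + 1 < Fintype.card F) :
    ∑ x : F, ((algebraMap F K x / r - 1)⁻¹) ^ (j + 1) = 1 := by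
  have : Fact (Nat.Prime 3) := ⟨Nat.prime_three⟩
  have h3 : (3 : K) = 0 := by exact_mod_cast CharP.cast_eq_zero K 3
  have step (j : ℕ) (hj : j + 1 < Fintype.card F) (x : F) :
      ((algebraMap F K x / r - 1)⁻¹) ^ (j + 1) =
        ((algebraMap F K x / r - 1)⁻¹) ^ j
          + (algebraMap F K x / r - 1) ^ (Fintype.card F - 1 - j) := by
    have h0 := algebraMap_div_sub_one_ne_zero hr x
    have hp : (algebraMap F K x / r - 1) ^ Fintype.card F = -(algebraMap F K x / r) - 1 := by
      rw [← algebraMap_div_pow_card hr x, hn, sub_pow_char_pow, one_pow]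
    generalize algebraMap F K x / r = y at *
    have hs : (y - 1) ^ (Fintype.card F - 1 - j) * (y - 1) ^ (j + 1) = -y - 1 := by
      rw [← pow_add, ← hp]
      congr 1
      omega
    have h0' : (y - 1) ^ (j + 1) ≠ 0 := pow_ne_zero _ h0
    apply mul_right_cancel₀ h0'
    rw [add_mul, hs, ← mul_pow, inv_mul_cancel₀ h0, one_pow, pow_succ, ← mul_assoc, ← mul_pow,
      inv_mul_cancel₀ h0, one_pow]
    linear_combination h3
  induction j with
  | zero =>
    have hc : ((Fintype.card F : ℕ) : K) = 0 := by
      rw [← map_natCast (algebraMap F K), FiniteField.cast_card_eq_zero, map_zero]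
    simp only [step 0 hj, Finset.sum_add_distrib]
    rw [sum_sub_one_pow _ _ (by omega), Nat.sub_zero, sum_algebraMap_div_pow_card_sub_one hr0 hr]
    simp [hc]
  | succ j ih =>
    simp only [step (j + 1) hj, Finset.sum_add_distrib]
    rw [ih (by omega), sum_sub_one_pow _ _ (by omega), sum_algebraMap_div_pow _ _ (by omega),
      add_zero]

lemma sum_inv_add_one_pow [CharP K 3] {n : ℕ} (hn : Fintype.card F = 3 ^ n) {r : K}
    (hr0 : r ≠ 0) (hr : r ^ Fintype.card F = -r) (j : ℕ) (hj : j + 1 < Fintype.card F) :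
    ∑ x : F, ((algebraMap F K x / r + 1)⁻¹) ^ (j + 1) = (-1) ^ (j + 1) := by
  have hodd : Odd (Fintype.card F) := hn ▸ Odd.pow (by decide)
  have h := sum_inv_sub_one_pow hn (neg_ne_zero.2 hr0)
    (by rw [hodd.neg_pow, hr] : (-r) ^ Fintype.card F = -(-r)) j hj
  have e (x : F) : algebraMap F K x / -r - 1 = -(algebraMap F K x / r + 1) := by
    rw [div_neg]
    ring
  simp only [e, inv_neg, neg_pow (_ : K)⁻¹, ← Finset.mul_sum] at h
  generalize ∑ x : F, ((algebraMap F K x / r + 1)⁻¹) ^ (j + 1) = S at *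
  have hs : ((-1 : K) ^ (j + 1)) * (-1) ^ (j + 1) = 1 := by
    rw [← mul_pow]
    simp
  linear_combination (-1 : K) ^ (j + 1) * h - S * hs

lemma pow_card_eq_neg_of_sq_mem_range (hF : ringChar F ≠ 2) {r : K}
    (hr : r ∉ Set.range (algebraMap F K)) (hr2 : r ^ 2 ∈ Set.range (algebraMap F K)) :
    r ^ Fintype.card F = -r := by
  obtain ⟨R, hR⟩ := hr2
  have hR0 : R ≠ 0 := by
    rintro rfl
    rw [map_zero, eq_comm, sq_eq_zero_iff] at hR
    exact hr ⟨0, by rw [hR, map_zero]⟩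
  have hns : ¬ IsSquare R := by
    rintro ⟨s, rfl⟩
    rw [map_mul, ← sq, eq_comm, sq_eq_sq_iff_eq_or_eq_neg] at hR
    rcases hR with h | h
    · exact hr ⟨s, h.symm⟩
    · exact hr ⟨-s, by rw [map_neg, h]⟩
  have hpow : R ^ (Fintype.card F / 2) = -1 :=
    (FiniteField.pow_dichotomy hF hR0).resolve_left
      fun h => hns ((FiniteField.isSquare_iff hF hR0).2 h)
  have hodd := FiniteField.odd_card_of_char_ne_two hF
  calc r ^ Fintype.card F = (r ^ 2) ^ (Fintype.card F / 2) * r := by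
        rw [← pow_mul, ← pow_succ]
        congr 1
        omega
    _ = -r := by rw [← hR, ← map_pow, hpow, map_neg, map_one, neg_one_mul]

end PowerSums

section PartialFractions

variable {K : Type*} [Field K]

lemma sq_partialFractions (h3 : (3 : K) = 0) (A B y U V : K) (hU : (y - 1) * U = 1)
    (hV : (y + 1) * V = 1) :
    (A * y ^ 2 + B * y + U + V) ^ 2 =
      A ^ 2 * y ^ 4 + 2 * A * B * y ^ 3 + B ^ 2 * y ^ 2 + A * y ^ 1 + B * y ^ 0
        + (2 * A + 2 * B + 1) * U ^ 1 + (2 * A - 2 * B - 1) * V ^ 1 + U ^ 2 + V ^ 2 := by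
  have hUV : U * V = V - U := by
    grind
  grind

lemma pow_five_partialFractions (h3 : (3 : K) = 0) (A y U V : K) (hU : (y - 1) * U = 1)
    (hV : (y + 1) * V = 1) :
    (A * y ^ 2 - y + U + V) ^ 5 =
      (A - A ^ 3) * y ^ 0 + (A ^ 4 - A ^ 2) * y ^ 1 + (A ^ 3 - A) * y ^ 2 + (1 + A ^ 4) * y ^ 3
        - A * y ^ 4 + (A ^ 4 - 1) * y ^ 5 - (A + A ^ 3) * y ^ 6 + (A ^ 4 - A ^ 2) * y ^ 7
        + A ^ 3 * y ^ 8 + A ^ 4 * y ^ 9 + A ^ 5 * y ^ 10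
        - (1 + A ^ 3 + A ^ 4) * U ^ 1 + (1 - A + A ^ 2 + A ^ 3) * U ^ 2 + A ^ 2 * U ^ 3
        - (1 + A) * U ^ 4 + U ^ 5
        + (A ^ 3 - 1 - A ^ 4) * V ^ 1 + (A ^ 3 - 1 - A - A ^ 2) * V ^ 2 + A ^ 2 * V ^ 3
        + (1 - A) * V ^ 4 + V ^ 5 := by
  have hUV : U * V = V - U := by
    grind
  have hyU : y * U = 1 + U := by
    grind
  have hyV : y * V = 1 - V := by
    grind
  have cube (a b : K) : (a + b) ^ 3 = a ^ 3 + b ^ 3 := by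
    linear_combination (a ^ 2 * b + a * b ^ 2) * h3
  have h2 : (A * y ^ 2 - y + U + V) ^ 2 = A ^ 2 * y ^ 4 + A * y ^ 3 + y ^ 2 + A * y - 1
      + (2 * A - 1) * U + (2 * A + 1) * V + U ^ 2 + V ^ 2 := by
    grind
  have h3' : (A * y ^ 2 - y + U + V) ^ 3 = A ^ 3 * y ^ 6 - y ^ 3 + U ^ 3 + V ^ 3 := by
    rw [cube, cube, sub_eq_add_neg, cube]
    ring
  rw [show (5 : ℕ) = 3 + 2 from rfl, pow_add, h2, h3']
  grind

end PartialFractions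

section Injective

variable {F K : Type*} [Field F] [Fintype F] [Field K] [Algebra F K]

lemma sum_pow_eq_zero_of_injective {f : F → K} (hf : Function.Injective f)
    (hr : ∀ x, f x ∈ Set.range (algebraMap F K)) (k : ℕ) (hk : k < Fintype.card F - 1) :
    ∑ x, f x ^ k = 0 := by
  choose g hg using hr
  have hgi : Function.Injective g := fun x y h => hf (by rw [← hg, ← hg, h])
  have hs : ∑ x, g x ^ k = ∑ x, x ^ k :=
    (Finite.injective_iff_bijective.1 hgi).sum_comp fun x => x ^ k
  simp only [← hg, ← map_pow, ← map_sum, hs, FiniteField.sum_pow_lt_card_sub_one F k hk, map_zero]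

lemma not_injective_of_pow_card_eq_neg [CharP K 3] {n : ℕ} (hn : Fintype.card F = 3 ^ n)
    (hn3 : 3 ≤ n) {r : K} (hr0 : r ≠ 0) (hr : r ^ Fintype.card F = -r)
    (hr2 : r ^ 2 ∈ Set.range (algebraMap F K)) {a b : F} (ha : a ≠ 0) :
    ¬ Function.Injective fun x : F =>
      algebraMap F K (a * x ^ 2 + b * x) + (algebraMap F K x - r)⁻¹
        + (algebraMap F K x + r)⁻¹ := by
  intro hinj
  have h3 : (3 : K) = 0 := by exact_mod_cast CharP.cast_eq_zero K 3
  have hq : 27 ≤ Fintype.card F := hn ▸ Nat.pow_le_pow_right (n := 3) (by norm_num) hn3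
  have h_sub (x : F) := algebraMap_div_sub_one_ne_zero hr x
  have h_add (x : F) : algebraMap F K x / r + 1 ≠ 0 := by
    have := h_sub (-x)
    rw [map_neg, neg_div] at this
    contrapose! this
    linear_combination -this
  have h_sub' (x : F) : algebraMap F K x - r ≠ 0 :=
    fun h => h_sub x (by rw [div_sub_one hr0, h, zero_div])
  have h_add' (x : F) : algebraMap F K x + r ≠ 0 :=
    fun h => h_add x (by rw [div_add_one hr0, h, zero_div])
  set A := algebraMap F K a * r ^ 3 with hA
  set B := algebraMap F K b * r ^ 2 with hB
  have hscale (x : F) : A * (algebraMap F K x / r) ^ 2 + B * (algebraMap F K x / r)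
      + (algebraMap F K x / r - 1)⁻¹ + (algebraMap F K x / r + 1)⁻¹ =
      r * (algebraMap F K (a * x ^ 2 + b * x) + (algebraMap F K x - r)⁻¹
        + (algebraMap F K x + r)⁻¹) := by
    have e1 : (algebraMap F K x / r - 1)⁻¹ = r * (algebraMap F K x - r)⁻¹ := by
      rw [div_sub_one hr0, inv_div, div_eq_mul_inv]
    have e2 : (algebraMap F K x / r + 1)⁻¹ = r * (algebraMap F K x + r)⁻¹ := by
      rw [div_add_one hr0, inv_div, div_eq_mul_inv]
    rw [e1, e2, hA, hB, map_add, map_mul, map_mul, map_pow]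
    field_simp
  have hrange (x : F) : algebraMap F K (a * x ^ 2 + b * x) + (algebraMap F K x - r)⁻¹
        + (algebraMap F K x + r)⁻¹ ∈ Set.range (algebraMap F K) := by
    obtain ⟨R, hR⟩ := hr2
    refine ⟨a * x ^ 2 + b * x + 2 * x / (x ^ 2 - R), ?_⟩
    have hd : algebraMap F K x ^ 2 - r ^ 2 ≠ 0 := by
      rw [sq_sub_sq]
      exact mul_ne_zero (h_add' x) (h_sub' x)
    have h1 := h_sub' x
    have h2 := h_add' x
    rw [map_add (algebraMap F K) (a * x ^ 2 + b * x), map_div₀, map_sub, hR, map_pow, map_mul,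
      map_ofNat, add_assoc]
    congr 1
    generalize algebraMap F K x = y at *
    field_simp
    ring
  have hsum (k : ℕ) (hk : k < Fintype.card F - 1) :
      ∑ x : F, (A * (algebraMap F K x / r) ^ 2 + B * (algebraMap F K x / r)
        + (algebraMap F K x / r - 1)⁻¹ + (algebraMap F K x / r + 1)⁻¹) ^ k = 0 := by
    simp only [hscale, mul_pow r, ← Finset.mul_sum]
    rw [sum_pow_eq_zero_of_injective hinj hrange k hk, mul_zero]
  have hy (i : ℕ) (hi : i < 26) : ∑ x : F, (algebraMap F K x / r) ^ i = 0 :=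
    sum_algebraMap_div_pow r i (by omega)
  have hU (j : ℕ) (hj : j < 26) : ∑ x : F, ((algebraMap F K x / r - 1)⁻¹) ^ (j + 1) = 1 :=
    sum_inv_sub_one_pow hn hr0 hr j (by omega)
  have hV (j : ℕ) (hj : j < 26) :
      ∑ x : F, ((algebraMap F K x / r + 1)⁻¹) ^ (j + 1) = (-1) ^ (j + 1) :=
    sum_inv_add_one_pow hn hr0 hr j (by omega)
  have hB1 : B = -1 := by
    have h := hsum 2 (by omega)
    simp only [sq_partialFractions h3 A B _ _ _ (mul_inv_cancel₀ (h_sub _))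
      (mul_inv_cancel₀ (h_add _)), Finset.sum_add_distrib, ← Finset.mul_sum] at h
    rw [hy 4 (by norm_num), hy 3 (by norm_num), hy 2 (by norm_num), hy 1 (by norm_num),
      hy 0 (by norm_num), hU 0 (by norm_num), hU 1 (by norm_num), hV 0 (by norm_num),
      hV 1 (by norm_num)] at h
    linear_combination h - (B + 1) * h3
  have hA0 : A = 0 := by
    have h := hsum 5 (by omega)
    simp only [hB1, neg_one_mul, ← sub_eq_add_neg] at h
    simp only [pow_five_partialFractions h3 A _ _ _ (mul_inv_cancel₀ (h_sub _))
      (mul_inv_cancel₀ (h_add _)), Finset.sum_add_distrib, Finset.sum_sub_distrib,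
      ← Finset.mul_sum] at h
    rw [hy 10 (by norm_num), hy 9 (by norm_num), hy 8 (by norm_num), hy 7 (by norm_num),
      hy 6 (by norm_num), hy 5 (by norm_num), hy 4 (by norm_num), hy 3 (by norm_num),
      hy 2 (by norm_num), hy 1 (by norm_num), hy 0 (by norm_num), hU 0 (by norm_num),
      hU 1 (by norm_num), hU 2 (by norm_num), hU 3 (by norm_num), hU 4 (by norm_num),
      hV 0 (by norm_num), hV 1 (by norm_num), hV 2 (by norm_num), hV 3 (by norm_num),
      hV 4 (by norm_num)] at h
    grind
  rw [hA, mul_eq_zero, map_eq_zero] at hA0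
  exact hA0.elim ha (pow_ne_zero 3 hr0)

end Injective

/-- For `q = 3^n`, `n ≥ 3`, `a ∈ F_q*`, `b ∈ F_q`, `r ∈ F_{q²} \ F_q` with `r² ∈ F_q`,
the map `x ↦ a·x² + b·x + 1/(x - r) + 1/(x + r)` is not injective on `F_q`. -/
theorem stmt_6 (n : ℕ) (hn : 3 ≤ n) (q : ℕ) (hq : q = 3 ^ n)
    (F K : Type*) [Field F] [Fintype F] [Field K] [Fintype K] [Algebra F K]
    (hF : Fintype.card F = q) (hK : Fintype.card K = q ^ 2)
    (a : F) (ha : a ≠ 0) (b : F)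
    (r : K) (hr : r ∉ Set.range (algebraMap F K))
    (hr2 : r ^ 2 ∈ Set.range (algebraMap F K)) :
    ¬ Function.Injective fun x : F =>
      algebraMap F K (a * x ^ 2 + b * x) + (algebraMap F K x - r)⁻¹
        + (algebraMap F K x + r)⁻¹ := by
  have : Fact (Nat.Prime 3) := ⟨Nat.prime_three⟩
  have hcard : Fintype.card F = 3 ^ n := hF.trans hq
  have hchar : CharP F 3 := charP_of_card_eq_prime_pow hcard
  have : CharP K 3 := charP_of_injective_algebraMap (algebraMap F K).injective 3
  have hne : ringChar F ≠ 2 := by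
    rw [ringChar.eq F 3]
    norm_num
  have hr0 : r ≠ 0 := by
    rintro rfl
    exact hr ⟨0, map_zero _⟩
  exact not_injective_of_pow_card_eq_neg hcard hn hr0 (pow_card_eq_neg_of_sq_mem_range hne hr hr2)
    hr2 ha
end

section
/- Let q = 3^n with n ≥ 3, let a ∈ F_q with a ≠ 0, and let r ∈ F_{q^3} with r ∉ F_q. The map from F_q to F_{q^3} sending x to a·x + 1/(x − r) + 1/(x − r^q) + 1/(x − r^{q^2}) is injective if and only if r + r^q + r^{q^2} = 0 and a = −(r − r^q)^{−2}. -/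
open Polynomial

section FiniteFieldSums

variable {F K : Type*} [Field F] [Fintype F] [Field K] [Algebra F K]

theorem sum_eval_algebraMap_eq_neg_coeff (p : K[X]) (hp : p.natDegree ≤ Fintype.card F - 1) :
    ∑ x : F, p.eval (algebraMap F K x) = -p.coeff (Fintype.card F - 1) := by
  classical
  have hq : 1 < Fintype.card F := Fintype.one_lt_card
  have htop : ∑ x : F, x ^ (Fintype.card F - 1) = -1 := by
    have h : ∀ x : F, x ^ (Fintype.card F - 1) = 1 - if x = 0 then 1 else 0 := by
      intro x
      split_ifs with hx
      · rw [hx, zero_pow (by omega), sub_self]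
      · rw [FiniteField.pow_card_sub_one_eq_one x hx, sub_zero]
    simp [h, Finset.sum_sub_distrib]
  simp_rw [eval_eq_sum_range' (Nat.lt_succ_of_le hp)]
  rw [Finset.sum_comm, Finset.sum_range_succ, Finset.sum_eq_zero]
  · rw [zero_add, ← Finset.mul_sum]
    simp_rw [← map_pow]
    rw [← map_sum, htop]
    simp
  · intro i hi
    rw [← Finset.mul_sum]
    simp_rw [← map_pow]
    rw [← map_sum, FiniteField.sum_pow_lt_card_sub_one F i (Finset.mem_range.mp hi)]
    simp

theorem mem_range_algebraMap_of_pow_card_eq {x : K} (hx : x ^ Fintype.card F = x) :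
    x ∈ Set.range (algebraMap F K) := by
  classical
  by_contra hmem
  have hq : 1 < Fintype.card F := Fintype.one_lt_card
  let s : Finset K := insert x (Finset.univ.image (algebraMap F K))
  have hs : s.card = Fintype.card F + 1 := by
    rw [Finset.card_insert_of_notMem (by simpa using hmem),
      Finset.card_image_of_injective _ (algebraMap F K).injective, Finset.card_univ]
  refine FiniteField.X_pow_card_sub_X_ne_zero K hq
    (eq_zero_of_natDegree_lt_card_of_eval_eq_zero' _ s ?_ ?_)
  · intro y hy
    rcases Finset.mem_insert.mp hy with rfl | hy
    · simp [hx]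
    · obtain ⟨z, -, rfl⟩ := Finset.mem_image.mp hy
      simp [← map_pow, FiniteField.pow_card]
  · rw [FiniteField.X_pow_card_sub_X_natDegree_eq K hq, hs]
    omega

theorem three_eq_zero_of_card {n : ℕ} (hF : Fintype.card F = 3 ^ n) : (3 : F) = 0 := by
  have h := FiniteField.cast_card_eq_zero F
  rw [hF] at h
  push_cast at h
  exact eq_zero_of_pow_eq_zero h

theorem sum_inv_algebraMap_sub {p n : ℕ} [Fact p.Prime] [CharP K p]
    (hF : Fintype.card F = p ^ n) {r : K} (hr : r ∉ Set.range (algebraMap F K)) :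
    ∑ x : F, (algebraMap F K x - r)⁻¹ = (r ^ Fintype.card F - r)⁻¹ := by
  have hq : 1 < Fintype.card F := Fintype.one_lt_card
  have hd : r ^ Fintype.card F - r ≠ 0 := fun h =>
    hr (mem_range_algebraMap_of_pow_card_eq (sub_eq_zero.mp h))
  have key : ∀ x : F, (r ^ Fintype.card F - r) * (algebraMap F K x - r)⁻¹ =
      1 - ((X - C r) ^ (Fintype.card F - 1)).eval (algebraMap F K x) := by
    intro x
    have hu : algebraMap F K x - r ≠ 0 := fun h => hr ⟨x, sub_eq_zero.mp h⟩
    have hpow : (algebraMap F K x - r) ^ Fintype.card F =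
        algebraMap F K x - r ^ Fintype.card F := by
      have h := sub_pow_char_pow (p := p) (n := n) (algebraMap F K x) r
      rw [← hF, ← map_pow, FiniteField.pow_card] at h
      exact h
    have hsucc : (algebraMap F K x - r) ^ (Fintype.card F - 1) * (algebraMap F K x - r) =
        algebraMap F K x - r ^ Fintype.card F := by
      rw [← pow_succ, Nat.sub_add_cancel hq.le, hpow]
    simp only [eval_pow, eval_sub, eval_X, eval_C]
    field_simp
    linear_combination hsucc
  have hcard : ((Fintype.card F : ℕ) : K) = 0 := by
    rw [← map_natCast (algebraMap F K), FiniteField.cast_card_eq_zero, map_zero]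
  have hmonic : ((X - C r) ^ (Fintype.card F - 1)).Monic := (monic_X_sub_C r).pow _
  have hdeg : ((X - C r) ^ (Fintype.card F - 1)).natDegree = Fintype.card F - 1 := by
    simp [(monic_X_sub_C r).natDegree_pow]
  have hcoeff : ((X - C r) ^ (Fintype.card F - 1)).coeff (Fintype.card F - 1) = 1 := by
    have h := hmonic.coeff_natDegree
    rwa [hdeg] at h
  have hsum : (r ^ Fintype.card F - r) * ∑ x : F, (algebraMap F K x - r)⁻¹ = 1 := by
    rw [Finset.mul_sum, Finset.sum_congr rfl fun x _ => key x, Finset.sum_sub_distrib,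
      sum_eval_algebraMap_eq_neg_coeff _ hdeg.le, hcoeff]
    simp [hcard]
  exact eq_inv_of_mul_eq_one_right hsum

theorem sum_pow_comp_eq_zero_of_injective {f : F → F} (hf : Function.Injective f) {k : ℕ}
    (hk : k < Fintype.card F - 1) : ∑ y, f y ^ k = 0 := by
  rw [(Finite.injective_iff_bijective.mp hf).sum_comp fun y => y ^ k]
  exact FiniteField.sum_pow_lt_card_sub_one F k hk

end FiniteFieldSums

section ArtinSchreier

theorem sum_pow_three_pow_sub {R : Type*} [CommRing R] [CharP R 3] (n : ℕ) (w : R) :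
    ∑ m ∈ Finset.range n, (w ^ 3 - w) ^ 3 ^ m = w ^ 3 ^ n - w := by
  have : Fact (Nat.Prime 3) := ⟨Nat.prime_three⟩
  have h : ∀ m, (w ^ 3 - w) ^ 3 ^ m = w ^ 3 ^ (m + 1) - w ^ 3 ^ m := by
    intro m
    rw [sub_pow_char_pow, ← pow_mul, pow_succ' 3 m]
  simp_rw [h]
  rw [Finset.sum_range_sub fun m => w ^ 3 ^ m]
  simp

theorem artinSchreier_periodic {R : Type*} [CommRing R] (h3 : (3 : R) = 0) (c y : R) :
    (y + 1) ^ 3 - (y + 1) - c = y ^ 3 - y - c := by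
  linear_combination (y ^ 2 + y) * h3

variable {F : Type*} [Field F] [Fintype F]

theorem sum_pow_three_pow_artinSchreier {n : ℕ} (hF : Fintype.card F = 3 ^ n) {c : F}
    (hc : ∑ m ∈ Finset.range n, c ^ 3 ^ m = 1) (y : F) :
    ∑ m ∈ Finset.range n, (y ^ 3 - y - c) ^ 3 ^ m = -1 := by
  have : Fact (Nat.Prime 3) := ⟨Nat.prime_three⟩
  have : CharP F 3 := charP_of_card_eq_prime_pow hF
  have h : ∀ m, (y ^ 3 - y - c) ^ 3 ^ m = (y ^ 3 - y) ^ 3 ^ m - c ^ 3 ^ m :=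
    fun m => sub_pow_char_pow ..
  simp_rw [h]
  rw [Finset.sum_sub_distrib, sum_pow_three_pow_sub, ← hF, FiniteField.pow_card, hc, sub_self,
    zero_sub]

theorem artinSchreier_ne_zero {n : ℕ} (hF : Fintype.card F = 3 ^ n) {c : F}
    (hc : ∑ m ∈ Finset.range n, c ^ 3 ^ m = 1) (y : F) : y ^ 3 - y - c ≠ 0 := by
  intro h
  have h1 := sum_pow_three_pow_artinSchreier hF hc y
  rw [h] at h1
  simp at h1

theorem sum_sq_mul_artinSchreier_pow (c : F) {e : ℕ} (he : 3 * e + 2 ≤ Fintype.card F - 1) :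
    ∑ y : F, y ^ 2 * (y ^ 3 - y - c) ^ e = if 3 * e + 2 = Fintype.card F - 1 then -1 else 0 := by
  have hP : (X ^ 3 - X - C c : F[X]).Monic := by monicity!
  have hPdeg : (X ^ 3 - X - C c : F[X]).natDegree = 3 := by compute_degree!
  have hmonic : (X ^ 2 * (X ^ 3 - X - C c) ^ e : F[X]).Monic := (monic_X_pow 2).mul (hP.pow e)
  have hdeg : (X ^ 2 * (X ^ 3 - X - C c) ^ e : F[X]).natDegree = 3 * e + 2 := by
    rw [(monic_X_pow 2).natDegree_mul (hP.pow e), hP.natDegree_pow, hPdeg, natDegree_X_pow]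
    ring
  have h := sum_eval_algebraMap_eq_neg_coeff (F := F) _ (hdeg.trans_le he)
  simp only [Algebra.algebraMap_self, RingHom.id_apply, eval_mul, eval_pow, eval_sub, eval_X,
    eval_C] at h
  rw [h]
  split_ifs with hq
  · rw [← hq, ← hdeg, hmonic.coeff_natDegree]
  · rw [coeff_eq_zero_of_natDegree_lt (by omega), neg_zero]

theorem sum_sq_mul_artinSchreier_pow_eq_zero (c : F) {e : ℕ}
    (he : 3 * e + 2 < Fintype.card F - 1) :
    ∑ y : F, y ^ 2 * (y ^ 3 - y - c) ^ e = 0 := by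
  rw [sum_sq_mul_artinSchreier_pow c he.le, if_neg he.ne]

/-- The sum over `y` of `y ^ 2 / (y ^ 3 - y - c) ^ j`. -/
def artinSchreierSum (c : F) (j : ℕ) : F := ∑ y : F, y ^ 2 * ((y ^ 3 - y - c)⁻¹) ^ j

theorem artinSchreierSum_one {n : ℕ} (hn : 3 ≤ n) (hF : Fintype.card F = 3 ^ n) {c : F}
    (hc : ∑ m ∈ Finset.range n, c ^ 3 ^ m = 1) : artinSchreierSum c 1 = 1 := by
  obtain ⟨k, rfl⟩ : ∃ k, n = k + 1 := ⟨n - 1, by omega⟩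
  have hpt : ∀ y : F, y ^ 2 * ((y ^ 3 - y - c)⁻¹) ^ 1 =
      -∑ m ∈ Finset.range (k + 1), y ^ 2 * (y ^ 3 - y - c) ^ (3 ^ m - 1) := by
    intro y
    have hP := artinSchreier_ne_zero hF hc y
    have h := sum_pow_three_pow_artinSchreier hF hc y
    have hm : ∀ m, (y ^ 3 - y - c) ^ (3 ^ m - 1) =
        (y ^ 3 - y - c) ^ 3 ^ m * (y ^ 3 - y - c)⁻¹ := fun m => by
      rw [pow_sub₀ _ hP (Nat.one_le_pow _ 3 (by norm_num)), pow_one]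
    simp_rw [hm]
    rw [← Finset.mul_sum, ← Finset.sum_mul, h]
    ring
  rw [artinSchreierSum, Finset.sum_congr rfl fun y _ => hpt y, Finset.sum_neg_distrib,
    Finset.sum_comm, Finset.sum_range_succ, Finset.sum_eq_zero, zero_add]
  · have h1 : 1 ≤ 3 ^ k := Nat.one_le_pow _ 3 (by norm_num)
    have h2 : 3 * (3 ^ k - 1) + 2 = Fintype.card F - 1 := by rw [hF, pow_succ]; omega
    rw [sum_sq_mul_artinSchreier_pow c h2.le, if_pos h2, neg_neg]
  · intro m hm
    have hlt : 3 ^ m < 3 ^ k := Nat.pow_lt_pow_right (by norm_num) (Finset.mem_range.mp hm)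
    have h1 : 1 ≤ 3 ^ m := Nat.one_le_pow _ 3 (by norm_num)
    refine sum_sq_mul_artinSchreier_pow_eq_zero c ?_
    rw [hF, pow_succ]
    omega

theorem artinSchreierSum_recurrence {n : ℕ} (hn : 3 ≤ n) (hF : Fintype.card F = 3 ^ n) {c : F}
    (hc : ∑ m ∈ Finset.range n, c ^ 3 ^ m = 1) {j : ℕ} (hj : 2 ≤ j) (hj' : j ≤ 9) :
    artinSchreierSum c j = -artinSchreierSum c (j - 1) -
      ∑ y : F, y ^ 2 * ((y ^ 3 - y - c) ^ 3 * ((y ^ 3 - y - c)⁻¹) ^ j) := by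
  obtain ⟨k, rfl⟩ : ∃ k, n = k + 2 := ⟨n - 2, by omega⟩
  have hpt : ∀ y : F, y ^ 2 * ((y ^ 3 - y - c)⁻¹) ^ j =
      -(y ^ 2 * ((y ^ 3 - y - c)⁻¹) ^ (j - 1)) -
        y ^ 2 * ((y ^ 3 - y - c) ^ 3 * ((y ^ 3 - y - c)⁻¹) ^ j) -
        ∑ m ∈ Finset.range k, y ^ 2 * (y ^ 3 - y - c) ^ (3 ^ (m + 2) - j) := by
    intro y
    have hP := artinSchreier_ne_zero hF hc y
    have h := sum_pow_three_pow_artinSchreier hF hc y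
    rw [Finset.sum_range_succ', Finset.sum_range_succ'] at h
    have hm : ∀ m, (y ^ 3 - y - c) ^ (3 ^ (m + 2) - j) =
        (y ^ 3 - y - c) ^ 3 ^ (m + 2) * ((y ^ 3 - y - c)⁻¹) ^ j := fun m => by
      have : 1 ≤ 3 ^ m := Nat.one_le_pow _ 3 (by norm_num)
      rw [pow_sub₀ _ hP (by rw [pow_add]; omega), inv_pow]
    have hjj : ((y ^ 3 - y - c)⁻¹) ^ (j - 1) = (y ^ 3 - y - c) * ((y ^ 3 - y - c)⁻¹) ^ j := by
      obtain ⟨i, rfl⟩ : ∃ i, j = i + 1 := ⟨j - 1, by omega⟩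
      rw [Nat.add_sub_cancel, pow_succ' (y ^ 3 - y - c)⁻¹, mul_inv_cancel_left₀ hP]
    simp_rw [hm]
    rw [← Finset.mul_sum, ← Finset.sum_mul, hjj]
    norm_num at h
    linear_combination (y ^ 2 * ((y ^ 3 - y - c)⁻¹) ^ j) * h
  rw [artinSchreierSum, Finset.sum_congr rfl fun y _ => hpt y, Finset.sum_sub_distrib,
    Finset.sum_sub_distrib, Finset.sum_neg_distrib,
    Finset.sum_comm (s := Finset.univ) (t := Finset.range k),
    Finset.sum_eq_zero (s := Finset.range k), sub_zero, artinSchreierSum]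
  intro m hm
  have hle : 3 ^ (m + 2) ≤ 3 ^ (k + 1) :=
    Nat.pow_le_pow_right (by norm_num) (by have := Finset.mem_range.mp hm; omega)
  have h9 : 1 ≤ 3 ^ m := Nat.one_le_pow _ 3 (by norm_num)
  refine sum_sq_mul_artinSchreier_pow_eq_zero c ?_
  rw [hF, show k + 2 = (k + 1) + 1 by ring, pow_succ 3 (k + 1)]
  rw [pow_add] at hle ⊢
  omega

theorem artinSchreierSum_values {n : ℕ} (hn : 3 ≤ n) (hF : Fintype.card F = 3 ^ n) {c : F}
    (hc : ∑ m ∈ Finset.range n, c ^ 3 ^ m = 1) :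
    artinSchreierSum c 2 = -1 ∧ artinSchreierSum c 3 = 1 ∧ artinSchreierSum c 4 = 1 ∧
      artinSchreierSum c 6 = -1 := by
  have h3 := three_eq_zero_of_card hF
  have hq : 27 ≤ Fintype.card F := by
    rw [hF]
    exact Nat.pow_le_pow_right (by norm_num : 0 < 3) hn
  have hcancel : ∀ i, ∑ y : F, y ^ 2 * ((y ^ 3 - y - c) ^ 3 * ((y ^ 3 - y - c)⁻¹) ^ (i + 3)) =
      artinSchreierSum c i := by
    intro i
    refine Finset.sum_congr rfl fun y _ => ?_
    have hP := artinSchreier_ne_zero hF hc y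
    generalize y ^ 3 - y - c = P at hP ⊢
    rw [pow_add]
    field_simp
  have h2cancel : ∑ y : F, y ^ 2 * ((y ^ 3 - y - c) ^ 3 * ((y ^ 3 - y - c)⁻¹) ^ 2) = 0 := by
    rw [← sum_sq_mul_artinSchreier_pow_eq_zero c (e := 1) (by omega)]
    refine Finset.sum_congr rfl fun y _ => ?_
    have hP := artinSchreier_ne_zero hF hc y
    field_simp
  have s0 : artinSchreierSum c 0 = 0 := by
    simpa [artinSchreierSum] using
      sum_sq_mul_artinSchreier_pow_eq_zero c (e := 0) (by omega)
  have s1 := artinSchreierSum_one hn hF hc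
  have s2 := artinSchreierSum_recurrence hn hF hc (j := 2) (by norm_num) (by norm_num)
  have s3 := artinSchreierSum_recurrence hn hF hc (j := 3) (by norm_num) (by norm_num)
  have s4 := artinSchreierSum_recurrence hn hF hc (j := 4) (by norm_num) (by norm_num)
  have s5 := artinSchreierSum_recurrence hn hF hc (j := 5) (by norm_num) (by norm_num)
  have s6 := artinSchreierSum_recurrence hn hF hc (j := 6) (by norm_num) (by norm_num)
  rw [h2cancel] at s2
  rw [hcancel 0] at s3
  rw [hcancel 1] at s4
  rw [hcancel 2] at s5
  rw [hcancel 3] at s6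
  norm_num at s2 s3 s4 s5 s6
  rw [s1] at s2 s4
  have e2 : artinSchreierSum c 2 = -1 := by rw [s2]
  have e3 : artinSchreierSum c 3 = 1 := by rw [s3, s0, e2]; ring
  have e4 : artinSchreierSum c 4 = 1 := by rw [s4, e3]; linear_combination -h3
  have e5 : artinSchreierSum c 5 = 0 := by rw [s5, e4, e2]; ring
  have e6 : artinSchreierSum c 6 = -1 := by rw [s6, e5, e3]; ring
  exact ⟨e2, e3, e4, e6⟩

theorem sum_eq_zero_and_sum_id_mul_eq_zero_of_periodic {n : ℕ} (hF : Fintype.card F = 3 ^ n)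
    {φ : F → F} (hφ : ∀ y, φ (y + 1) = φ y) :
    ∑ y, φ y = 0 ∧ ∑ y, y * φ y = 0 := by
  have h3 := three_eq_zero_of_card hF
  have h1 : ∑ y, φ y = 0 := by
    have h := Equiv.sum_comp (Equiv.addRight (1 : F)) fun y => y * φ y
    simp only [Equiv.coe_addRight, hφ, add_mul, one_mul, Finset.sum_add_distrib] at h
    linear_combination h
  refine ⟨h1, ?_⟩
  have h := Equiv.sum_comp (Equiv.addRight (1 : F)) fun y => y ^ 2 * φ y
  have hexp : ∀ y : F, (y + 1) ^ 2 * φ y = y ^ 2 * φ y + 2 * (y * φ y) + φ y := fun y => by ring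
  simp only [Equiv.coe_addRight, hφ, hexp, Finset.sum_add_distrib, ← Finset.mul_sum, h1] at h
  linear_combination -h + (∑ y, y * φ y) * h3

theorem sum_sq_sub_mul_of_periodic {n : ℕ} (hF : Fintype.card F = 3 ^ n) (b : F)
    {h φ : F → F} (hh : ∀ y, h (y + 1) = h y) (hφ : ∀ y, φ (y + 1) = φ y) :
    ∑ y, (b * y - h y) ^ 2 * φ y = b ^ 2 * ∑ y, y ^ 2 * φ y := by
  have e1 := (sum_eq_zero_and_sum_id_mul_eq_zero_of_periodic hF
    (φ := fun y => h y * φ y) fun y => by rw [hh, hφ]).2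
  have e2 := (sum_eq_zero_and_sum_id_mul_eq_zero_of_periodic hF
    (φ := fun y => h y ^ 2 * φ y) fun y => by rw [hh, hφ]).1
  have hexp : ∀ y, (b * y - h y) ^ 2 * φ y =
      b ^ 2 * (y ^ 2 * φ y) - 2 * b * (y * (h y * φ y)) + h y ^ 2 * φ y := fun y => by ring
  simp_rw [hexp]
  rw [Finset.sum_add_distrib, Finset.sum_sub_distrib, ← Finset.mul_sum, ← Finset.mul_sum, e1, e2]
  ring

theorem eq_neg_one_of_injective {n : ℕ} (hn : 3 ≤ n) (hF : Fintype.card F = 3 ^ n) {b c : F}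
    (hb : b ≠ 0) (hc : ∑ m ∈ Finset.range n, c ^ 3 ^ m = 1)
    (hinj : Function.Injective fun y : F => b * y - (y ^ 3 - y - c)⁻¹) : b = -1 := by
  have h3 := three_eq_zero_of_card hF
  have hq : 27 ≤ Fintype.card F := by
    rw [hF]
    exact Nat.pow_le_pow_right (by norm_num : 0 < 3) hn
  have hper := artinSchreier_periodic h3 c
  have s1 := artinSchreierSum_one hn hF hc
  obtain ⟨s2, s3, s4, s6⟩ := artinSchreierSum_values hn hF hc
  have hsum : ∀ k < 26, ∑ y : F, (b * y - (y ^ 3 - y - c)⁻¹) ^ k = 0 := fun k hk =>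
    sum_pow_comp_eq_zero_of_injective hinj (by omega)
  have hpoly : ∀ e ≤ 2, ∑ y : F, y ^ 2 * (y ^ 3 - y - c) ^ e = 0 := fun e he =>
    sum_sq_mul_artinSchreier_pow_eq_zero c (by omega)
  have p0 := hpoly 0 (by norm_num)
  have p1 := hpoly 1 (by norm_num)
  have p2 := hpoly 2 (by norm_num)
  simp only [pow_zero, pow_one, mul_one] at p0 p1
  unfold artinSchreierSum at s1 s2 s3 s4 s6
  have hb2 : b ^ 2 = 1 := by
    have key := sum_sq_sub_mul_of_periodic hF b (h := fun y => (y ^ 3 - y - c)⁻¹)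
      (φ := fun y => b ^ 3 * (y ^ 3 - y - c + c) - ((y ^ 3 - y - c)⁻¹) ^ 3 +
        b ^ 2 * (y ^ 3 - y - c)⁻¹) (fun y => by rw [hper]) (fun y => by rw [hper])
    have hl : ∀ y : F, (b * y - (y ^ 3 - y - c)⁻¹) ^ 2 * (b ^ 3 * (y ^ 3 - y - c + c) -
        ((y ^ 3 - y - c)⁻¹) ^ 3 + b ^ 2 * (y ^ 3 - y - c)⁻¹) =
        (b * y - (y ^ 3 - y - c)⁻¹) ^ 5 - b ^ 2 * (b * y - (y ^ 3 - y - c)⁻¹) ^ 3 := by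
      intro y
      generalize (y ^ 3 - y - c)⁻¹ = h
      linear_combination (b * y - h) ^ 2 * (b ^ 2 * y ^ 2 * h - b * y * h ^ 2) * h3
    have hr : ∀ y : F, y ^ 2 * (b ^ 3 * (y ^ 3 - y - c + c) -
        ((y ^ 3 - y - c)⁻¹) ^ 3 + b ^ 2 * (y ^ 3 - y - c)⁻¹) =
        b ^ 3 * (y ^ 2 * (y ^ 3 - y - c)) + b ^ 3 * c * y ^ 2 -
        y ^ 2 * ((y ^ 3 - y - c)⁻¹) ^ 3 + b ^ 2 * (y ^ 2 * ((y ^ 3 - y - c)⁻¹) ^ 1) := by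
      intro y
      ring
    simp only [hl, hr, Finset.sum_sub_distrib, Finset.sum_add_distrib, ← Finset.mul_sum,
      p0, p1, s1, s3, hsum 5 (by norm_num), hsum 3 (by norm_num)] at key
    have : b ^ 2 * (b ^ 2 - 1) = 0 := by linear_combination -key
    exact sub_eq_zero.mp ((mul_eq_zero.mp this).resolve_left (pow_ne_zero 2 hb))
  have key := sum_sq_sub_mul_of_periodic hF b (h := fun y => (y ^ 3 - y - c)⁻¹)
    (φ := fun y => (b * (y ^ 3 - y - c) - ((y ^ 3 - y - c)⁻¹) ^ 3 + (y ^ 3 - y - c)⁻¹) ^ 2)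
    (fun y => by rw [hper]) (fun y => by rw [hper])
  have hl : ∀ y : F, (b * y - (y ^ 3 - y - c)⁻¹) ^ 2 *
      (b * (y ^ 3 - y - c) - ((y ^ 3 - y - c)⁻¹) ^ 3 + (y ^ 3 - y - c)⁻¹) ^ 2 =
      (b * y - (y ^ 3 - y - c)⁻¹) ^ 8 - 2 * (b * y - (y ^ 3 - y - c)⁻¹) ^ 6 +
      (b * y - (y ^ 3 - y - c)⁻¹) ^ 4 - 2 * b * c * (b * y - (y ^ 3 - y - c)⁻¹) ^ 5 +
      2 * b * c * (b * y - (y ^ 3 - y - c)⁻¹) ^ 3 +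
      b ^ 2 * c ^ 2 * (b * y - (y ^ 3 - y - c)⁻¹) ^ 2 := by
    intro y
    have hw : b * (y ^ 3 - y - c) - ((y ^ 3 - y - c)⁻¹) ^ 3 + (y ^ 3 - y - c)⁻¹ =
        (b * y - (y ^ 3 - y - c)⁻¹) ^ 3 - (b * y - (y ^ 3 - y - c)⁻¹) - b * c := by
      generalize (y ^ 3 - y - c)⁻¹ = h
      linear_combination (b ^ 2 * y ^ 2 * h - b * y * h ^ 2) * h3 - b * y ^ 3 * hb2
    rw [hw]
    ring
  have hr : ∀ y : F, y ^ 2 *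
      (b * (y ^ 3 - y - c) - ((y ^ 3 - y - c)⁻¹) ^ 3 + (y ^ 3 - y - c)⁻¹) ^ 2 =
      b ^ 2 * (y ^ 2 * (y ^ 3 - y - c) ^ 2) + y ^ 2 * ((y ^ 3 - y - c)⁻¹) ^ 6 +
      (1 - 2 * b) * (y ^ 2 * ((y ^ 3 - y - c)⁻¹) ^ 2) + 2 * b * y ^ 2 -
      2 * (y ^ 2 * ((y ^ 3 - y - c)⁻¹) ^ 4) := by
    intro y
    have hP := mul_inv_cancel₀ (artinSchreier_ne_zero hF hc y)
    generalize (y ^ 3 - y - c)⁻¹ = h at hP ⊢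
    generalize y ^ 3 - y - c = P at hP ⊢
    linear_combination (2 * b - 2 * b * h ^ 2) * y ^ 2 * hP
  simp only [hl, hr, Finset.sum_sub_distrib, Finset.sum_add_distrib, ← Finset.mul_sum,
    p0, p2, s2, s4, s6, hsum 8 (by norm_num), hsum 6 (by norm_num), hsum 4 (by norm_num),
    hsum 5 (by norm_num), hsum 3 (by norm_num), hsum 2 (by norm_num), hb2] at key
  linear_combination key + (b - 1) * h3

theorem injective_neg_sub_inv {n : ℕ} (hF : Fintype.card F = 3 ^ n) {c : F}
    (hc : ∑ m ∈ Finset.range n, c ^ 3 ^ m = 1) :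
    Function.Injective fun y : F => -1 * y - (y ^ 3 - y - c)⁻¹ := by
  have h3 := three_eq_zero_of_card hF
  intro y z hyz
  by_contra hne
  have hP := artinSchreier_ne_zero hF hc y
  have hQ := artinSchreier_ne_zero hF hc z
  have ht : y - z ≠ 0 := sub_ne_zero.mpr hne
  obtain ⟨P, hPdef⟩ : ∃ P, P = y ^ 3 - y - c := ⟨_, rfl⟩
  obtain ⟨Q, hQdef⟩ : ∃ Q, Q = z ^ 3 - z - c := ⟨_, rfl⟩
  obtain ⟨t, htdef⟩ : ∃ t, t = y - z := ⟨_, rfl⟩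
  simp only [← hPdef, ← hQdef] at hyz hP hQ
  rw [← htdef] at ht
  have hPQ : P - Q = t ^ 3 - t := by
    rw [hPdef, hQdef, htdef]
    linear_combination (y ^ 2 * z - y * z ^ 2) * h3
  have hprod : P * Q = t ^ 2 - 1 := by
    field_simp at hyz
    refine mul_left_cancel₀ ht ?_
    rw [htdef] at hPQ ⊢
    linear_combination hPQ - hyz
  have hquad : P ^ 2 - P * (t ^ 3 - t) - (t ^ 2 - 1) = 0 := by
    linear_combination hprod + P * hPQ
  obtain ⟨v, hv⟩ : ∃ v, v ^ 3 - v = -P := by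
    by_cases h1 : t ^ 2 + 1 = 0
    · have hsq : (P + t) ^ 2 = 0 := by
        linear_combination hquad + (P * t + 2) * h1 - h3
      refine ⟨t, ?_⟩
      have := eq_zero_of_pow_eq_zero hsq
      linear_combination this + t * h1 - t * h3
    · obtain ⟨u, hu⟩ : ∃ u, (t ^ 2 + 1) * u = -(P + t ^ 3 - t) :=
        ⟨_, mul_div_cancel₀ _ h1⟩
      have hu2 : u ^ 2 = t ^ 2 - 1 := by
        refine mul_left_cancel₀ (pow_ne_zero 2 h1) ?_
        linear_combination ((t ^ 2 + 1) * u - (P + t ^ 3 - t)) * hu + hquad +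
          (P * (t ^ 3 - t) - t ^ 4 + t ^ 2) * h3
      refine ⟨t + u, ?_⟩
      linear_combination hu + u * hu2 + (t ^ 2 * u + t * u ^ 2 - u) * h3
  refine artinSchreier_ne_zero hF hc (y + v) ?_
  linear_combination hv - hPdef + (y ^ 2 * v + y * v ^ 2) * h3

end ArtinSchreier

section ConjugatePoles

variable {F K : Type*} [Field F] [Fintype F] [Field K] [Algebra F K]

theorem add_conjugates_eq_zero_of_injective {n : ℕ} (hn : n ≠ 0) (hF : Fintype.card F = 3 ^ n)
    (a : F) {r r₁ r₂ : K} (hr : r ∉ Set.range (algebraMap F K))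
    (h01 : r ^ Fintype.card F = r₁) (h12 : r₁ ^ Fintype.card F = r₂)
    (h20 : r₂ ^ Fintype.card F = r)
    (hinj : Function.Injective fun x : F => algebraMap F K (a * x) + (algebraMap F K x - r)⁻¹
      + (algebraMap F K x - r₁)⁻¹ + (algebraMap F K x - r₂)⁻¹) :
    r + r₁ + r₂ = 0 := by
  have : Fact (Nat.Prime 3) := ⟨Nat.prime_three⟩
  have : CharP F 3 := charP_of_card_eq_prime_pow hF
  have : CharP K 3 := charP_of_injective_algebraMap (algebraMap F K).injective 3
  have h3 : (3 : K) = 0 := by exact_mod_cast CharP.cast_eq_zero K 3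
  have hq : 2 < Fintype.card F := by
    rw [hF]
    exact lt_of_lt_of_le (by norm_num) (Nat.pow_le_pow_right (by norm_num : 0 < 3)
      (Nat.one_le_iff_ne_zero.mpr hn))
  have hsub : ∀ x y : K, (x - y) ^ Fintype.card F = x ^ Fintype.card F - y ^ Fintype.card F := by
    intro x y
    rw [hF]
    exact sub_pow_char_pow ..
  have hadd : ∀ x y : K, (x + y) ^ Fintype.card F = x ^ Fintype.card F + y ^ Fintype.card F := by
    intro x y
    rw [hF]
    exact add_pow_char_pow ..
  have hα : ∀ x : F, algebraMap F K x ^ Fintype.card F = algebraMap F K x := fun x => by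
    rw [← map_pow, FiniteField.pow_card]
  have hr₂ : r₂ ∉ Set.range (algebraMap F K) := by
    rintro ⟨z, rfl⟩
    exact hr ⟨z, by rw [← h20, hα]⟩
  have hr₁ : r₁ ∉ Set.range (algebraMap F K) := by
    rintro ⟨z, rfl⟩
    exact hr₂ ⟨z, by rw [← h12, hα]⟩
  have hmem : ∀ x : F, ∃ y : F, algebraMap F K y = algebraMap F K (a * x) +
      (algebraMap F K x - r)⁻¹ + (algebraMap F K x - r₁)⁻¹ + (algebraMap F K x - r₂)⁻¹ := by
    intro x
    refine mem_range_algebraMap_of_pow_card_eq ?_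
    simp only [hadd, inv_pow, hsub, hα, h01, h12, h20]
    ring
  choose g hg using hmem
  have hginj : Function.Injective g := fun x y hxy => hinj (by simp only [← hg, hxy])
  have hgsum := congrArg (algebraMap F K)
    (sum_pow_comp_eq_zero_of_injective hginj (k := 1) (by omega))
  have hid : ∑ x : F, algebraMap F K (a * x) = 0 := by
    have h := FiniteField.sum_pow_lt_card_sub_one F 1 (by omega)
    simp only [pow_one] at h
    rw [← map_sum, ← Finset.mul_sum, h, mul_zero, map_zero]
  simp only [pow_one, map_sum, map_zero, hg, Finset.sum_add_distrib, hid,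
    sum_inv_algebraMap_sub hF hr, sum_inv_algebraMap_sub hF hr₁,
    sum_inv_algebraMap_sub hF hr₂, h01, h12, h20] at hgsum
  have hd : r₁ - r ≠ 0 := fun h =>
    hr (mem_range_algebraMap_of_pow_card_eq (h01.trans (sub_eq_zero.mp h)))
  have hd₁ : r₂ - r₁ ≠ 0 := fun h =>
    hr₁ (mem_range_algebraMap_of_pow_card_eq (h12.trans (sub_eq_zero.mp h)))
  have hd₂ : r - r₂ ≠ 0 := fun h =>
    hr₂ (mem_range_algebraMap_of_pow_card_eq (h20.trans (sub_eq_zero.mp h)))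
  field_simp at hgsum
  refine eq_zero_of_pow_eq_zero (n := 2) ?_
  linear_combination -hgsum + (r * r₁ + r₁ * r₂ + r * r₂) * h3

theorem injective_iff_of_add_conjugates_eq_zero {n : ℕ} (hn : 3 ≤ n)
    (hF : Fintype.card F = 3 ^ n) {a : F} (ha : a ≠ 0) {r r₁ r₂ : K}
    (hr : r ∉ Set.range (algebraMap F K))
    (h01 : r ^ Fintype.card F = r₁) (h12 : r₁ ^ Fintype.card F = r₂)
    (hsum : r + r₁ + r₂ = 0) :
    (Function.Injective fun x : F => algebraMap F K (a * x) + (algebraMap F K x - r)⁻¹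
      + (algebraMap F K x - r₁)⁻¹ + (algebraMap F K x - r₂)⁻¹) ↔
    algebraMap F K a = -((r - r₁) ^ 2)⁻¹ := by
  have : Fact (Nat.Prime 3) := ⟨Nat.prime_three⟩
  have : CharP F 3 := charP_of_card_eq_prime_pow hF
  have : CharP K 3 := charP_of_injective_algebraMap (algebraMap F K).injective 3
  have h3 : (3 : K) = 0 := by exact_mod_cast CharP.cast_eq_zero K 3
  have hsub : ∀ x y : K, (x - y) ^ Fintype.card F = x ^ Fintype.card F - y ^ Fintype.card F := by
    intro x y
    rw [hF]
    exact sub_pow_char_pow ..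
  have hd : r₁ - r ≠ 0 := fun h =>
    hr (mem_range_algebraMap_of_pow_card_eq (h01.trans (sub_eq_zero.mp h)))
  obtain ⟨δ, hδ⟩ : r₁ - r ∈ Set.range (algebraMap F K) := by
    refine mem_range_algebraMap_of_pow_card_eq ?_
    rw [hsub, h01, h12]
    linear_combination hsum - r₁ * h3
  have hδK : algebraMap F K δ ≠ 0 := hδ ▸ hd
  have hδ0 : δ ≠ 0 := fun h => hδK (by rw [h, map_zero])
  have hδq : algebraMap F K δ ^ Fintype.card F = algebraMap F K δ := by
    rw [← map_pow, FiniteField.pow_card]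
  obtain ⟨ρ, hρ⟩ : ∃ ρ : K, r = algebraMap F K δ * ρ := ⟨_, (mul_div_cancel₀ _ hδK).symm⟩
  have hr₁ : r₁ = algebraMap F K δ * (ρ + 1) := by linear_combination -hδ + hρ
  have hr₂ : r₂ = algebraMap F K δ * (ρ - 1) := by
    linear_combination hsum - hρ - hr₁ - algebraMap F K δ * ρ * h3
  have hρq : ρ ^ Fintype.card F = ρ + 1 := by
    refine mul_left_cancel₀ hδK ?_
    rw [← hr₁, ← h01, hρ, mul_pow, hδq]
  obtain ⟨c, hc⟩ : ρ ^ 3 - ρ ∈ Set.range (algebraMap F K) := by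
    refine mem_range_algebraMap_of_pow_card_eq ?_
    rw [hsub, ← pow_mul, mul_comm, pow_mul, hρq]
    linear_combination (ρ ^ 2 + ρ) * h3
  have htrace : ∑ m ∈ Finset.range n, c ^ 3 ^ m = 1 := by
    apply (algebraMap F K).injective
    rw [map_sum, map_one]
    simp_rw [map_pow, hc]
    rw [sum_pow_three_pow_sub, ← hF, hρq]
    ring
  have hscale : ∀ y : F, algebraMap F K δ * (algebraMap F K (a * (δ * y)) +
      (algebraMap F K (δ * y) - r)⁻¹ + (algebraMap F K (δ * y) - r₁)⁻¹ +
      (algebraMap F K (δ * y) - r₂)⁻¹) =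
      algebraMap F K (a * δ ^ 2 * y - (y ^ 3 - y - c)⁻¹) := by
    intro y
    have hu : ∀ z : F, algebraMap F K y - ρ + algebraMap F K z ≠ 0 := fun z hz =>
      hr ⟨δ * (y + z), by
        rw [hρ, map_mul, map_add]
        linear_combination algebraMap F K δ * hz⟩
    have hu0 : algebraMap F K y - ρ ≠ 0 := by simpa using hu 0
    have hu1 : algebraMap F K y - ρ + 1 ≠ 0 := by simpa using hu 1
    have hu2 : algebraMap F K y - ρ - 1 ≠ 0 := by simpa [sub_eq_add_neg] using hu (-1)
    simp only [map_mul, map_sub, map_pow, map_inv₀, hc]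
    rw [hρ, hr₁, hr₂]
    have hP : algebraMap F K y ^ 3 - algebraMap F K y - (ρ ^ 3 - ρ) =
        (algebraMap F K y - ρ) * (algebraMap F K y - ρ + 1) * (algebraMap F K y - ρ - 1) := by
      linear_combination
        (algebraMap F K y ^ 2 * ρ - algebraMap F K y * ρ ^ 2) * h3
    rw [hP]
    generalize algebraMap F K y = Y at *
    obtain ⟨u, rfl⟩ : ∃ u, Y = u + ρ := ⟨Y - ρ, by ring⟩
    simp only [add_sub_cancel_right] at hu0 hu1 hu2 ⊢
    have e0 : algebraMap F K δ * (u + ρ) - algebraMap F K δ * ρ = algebraMap F K δ * u := by ring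
    have e1 : algebraMap F K δ * (u + ρ) - algebraMap F K δ * (ρ + 1) =
      algebraMap F K δ * (u - 1) := by ring
    have e2 : algebraMap F K δ * (u + ρ) - algebraMap F K δ * (ρ - 1) =
      algebraMap F K δ * (u + 1) := by ring
    rw [e0, e1, e2]
    field_simp
    linear_combination u ^ 2 * h3
  have hcore : (Function.Injective fun x : F => algebraMap F K (a * x) +
      (algebraMap F K x - r)⁻¹ + (algebraMap F K x - r₁)⁻¹ + (algebraMap F K x - r₂)⁻¹) ↔
      Function.Injective fun y : F => a * δ ^ 2 * y - (y ^ 3 - y - c)⁻¹ := by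
    constructor
    · intro h y z hyz
      refine mul_left_cancel₀ hδ0 (h (mul_left_cancel₀ hδK ?_))
      simp only [hscale]
      exact congrArg _ hyz
    · intro h x z hxz
      obtain ⟨x, rfl⟩ : ∃ y, x = δ * y := ⟨_, (mul_div_cancel₀ _ hδ0).symm⟩
      obtain ⟨z, rfl⟩ : ∃ y, z = δ * y := ⟨_, (mul_div_cancel₀ _ hδ0).symm⟩
      refine congrArg _ (h ((algebraMap F K).injective ?_))
      simp only [← hscale]
      exact congrArg _ hxz
  have hend : a * δ ^ 2 = -1 ↔ algebraMap F K a = -((r - r₁) ^ 2)⁻¹ := by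
    rw [← (algebraMap F K).injective.eq_iff, ← neg_sub r₁ r, ← hδ]
    simp only [map_mul, map_pow, map_neg, map_one, neg_sq]
    rw [eq_neg_iff_add_eq_zero, eq_neg_iff_add_eq_zero]
    field_simp
    rw [mul_zero]
  rw [hcore, ← hend]
  refine ⟨eq_neg_one_of_injective hn hF (mul_ne_zero ha (pow_ne_zero 2 hδ0)) htrace, fun h => ?_⟩
  rw [h]
  exact injective_neg_sub_inv hF htrace

end ConjugatePoles

/-- For `q = 3^n`, `n ≥ 3`, `a ∈ F_q*`, `r ∈ F_{q³} \ F_q`, the map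
`x ↦ a·x + 1/(x - r) + 1/(x - r^q) + 1/(x - r^{q²})` is injective on `F_q` iff
`r + r^q + r^{q²} = 0` and `a = -(r - r^q)⁻²`. -/
theorem stmt_8 (n : ℕ) (hn : 3 ≤ n) (q : ℕ) (hq : q = 3 ^ n)
    (F K : Type*) [Field F] [Fintype F] [Field K] [Fintype K] [Algebra F K]
    (hF : Fintype.card F = q) (hK : Fintype.card K = q ^ 3)
    (a : F) (ha : a ≠ 0)
    (r : K) (hr : r ∉ Set.range (algebraMap F K)) :
    (Function.Injective fun x : F =>
      algebraMap F K (a * x) + (algebraMap F K x - r)⁻¹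
        + (algebraMap F K x - r ^ q)⁻¹ + (algebraMap F K x - r ^ q ^ 2)⁻¹)
    ↔ (r + r ^ q + r ^ q ^ 2 = 0 ∧ algebraMap F K a = -((r - r ^ q) ^ 2)⁻¹) := by
  subst hq
  have h12 : (r ^ 3 ^ n) ^ Fintype.card F = r ^ (3 ^ n) ^ 2 := by
    rw [hF, ← pow_mul, ← sq]
  have h20 : (r ^ (3 ^ n) ^ 2) ^ Fintype.card F = r := by
    rw [hF, ← pow_mul, ← pow_succ, ← hK, FiniteField.pow_card]
  have h01 : r ^ Fintype.card F = r ^ 3 ^ n := by rw [hF]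
  constructor
  · intro h
    have hsum := add_conjugates_eq_zero_of_injective (by omega) hF a hr h01 h12 h20 h
    exact ⟨hsum, (injective_iff_of_add_conjugates_eq_zero hn hF ha hr h01 h12 hsum).mp h⟩
  · rintro ⟨hsum, h⟩
    exact (injective_iff_of_add_conjugates_eq_zero hn hF ha hr h01 h12 hsum).mpr h
end

section
/- Let q be an odd prime power with q > 3, let a ∈ F_q with a ≠ 0, and let r ∈ F_{q^2} with r ∉ F_q and r^2 ∈ F_q. Define f: F_q → F_{q^2} by f(x) = a·x + 1/(x − r) + 1/(x + r). Then the sum over all x ∈ F_q of f(x)^2 equals −(1 + 4·a·r^2) / (2·r^2). -/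
section CarlitzSums

open Finset

variable {F K : Type*} [Field F] [Field K] [Algebra F K]

theorem sub_algebraMap_ne_zero {y : K} (hy : y ∉ Set.range (algebraMap F K)) (x : F) :
    y - algebraMap F K x ≠ 0 :=
  fun h => hy ⟨x, (sub_eq_zero.1 h).symm⟩

variable [Fintype F]

theorem sum_pow_card_sub_one : ∑ x : F, x ^ (Fintype.card F - 1) = -1 := by
  classical
  have h1 : 1 < Fintype.card F := Fintype.one_lt_card
  rw [← Finset.add_sum_erase _ _ (mem_univ (0 : F)), zero_pow (by lia), zero_add,
    Finset.sum_congr rfl fun x hx => FiniteField.pow_card_sub_one_eq_one x (ne_of_mem_erase hx)]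
  simp [Finset.card_erase_of_mem, Nat.cast_sub h1.le]

theorem sum_algebraMap_pow_eq_zero {k : ℕ} (hk : k < Fintype.card F - 1) :
    ∑ x : F, algebraMap F K x ^ k = 0 := by
  simp_rw [← map_pow, ← map_sum, FiniteField.sum_pow_lt_card_sub_one F k hk, map_zero]

theorem sum_sub_algebraMap_pow (y : K) (k : ℕ) :
    ∑ x : F, (y - algebraMap F K x) ^ k =
      ∑ m ∈ range (k + 1),
        (∑ x : F, algebraMap F K x ^ m) * ((-1) ^ m * y ^ (k - m) * k.choose m) := by
  have h (x : F) : (y - algebraMap F K x) ^ k =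
      ∑ m ∈ range (k + 1), algebraMap F K x ^ m * ((-1) ^ m * y ^ (k - m) * k.choose m) := by
    rw [sub_eq_neg_add, add_pow]
    refine sum_congr rfl fun m _ => ?_
    rw [neg_pow]
    ring
  simp_rw [h]
  rw [sum_comm]
  simp_rw [sum_mul]

theorem sum_sub_algebraMap_pow_eq_zero (y : K) {k : ℕ} (hk : k < Fintype.card F - 1) :
    ∑ x : F, (y - algebraMap F K x) ^ k = 0 := by
  rw [sum_sub_algebraMap_pow]
  refine sum_eq_zero fun m hm => ?_
  rw [sum_algebraMap_pow_eq_zero (by have := mem_range.1 hm; lia), zero_mul]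

theorem sum_sub_algebraMap_pow_card_sub_one (hF : Odd (Fintype.card F)) (y : K) :
    ∑ x : F, (y - algebraMap F K x) ^ (Fintype.card F - 1) = -1 := by
  rw [sum_sub_algebraMap_pow, sum_range_succ, sum_eq_zero fun m hm => ?_]
  · simp_rw [← map_pow, ← map_sum, sum_pow_card_sub_one]
    simp [(Nat.Odd.sub_odd hF odd_one).neg_one_pow]
  · rw [sum_algebraMap_pow_eq_zero (mem_range.1 hm), zero_mul]

theorem sub_algebraMap_pow_card (y : K) (x : F) :
    (y - algebraMap F K x) ^ Fintype.card F =
      (y ^ Fintype.card F - y) + (y - algebraMap F K x) := by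
  have h := map_sub (FiniteField.frobeniusAlgHom F K) y (algebraMap F K x)
  rw [AlgHom.commutes] at h
  simp only [FiniteField.coe_frobeniusAlgHom] at h
  rw [h]
  ring

theorem sub_algebraMap_pow_card_sub_one {y : K} (hy : y ∉ Set.range (algebraMap F K)) (x : F) :
    (y - algebraMap F K x) ^ (Fintype.card F - 1) =
      (y ^ Fintype.card F - y) * (y - algebraMap F K x)⁻¹ + 1 := by
  have h0 := sub_algebraMap_ne_zero hy x
  have h := sub_algebraMap_pow_card y x
  rw [← pow_sub_one_mul Fintype.card_ne_zero (y - algebraMap F K x)] at h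
  field_simp
  linear_combination h

theorem natCast_card_eq_zero_of_algebra : (Fintype.card F : K) = 0 := by
  rw [← map_natCast (algebraMap F K), Nat.cast_card_eq_zero, map_zero]

theorem mul_sum_inv_sub_algebraMap (hF : Odd (Fintype.card F)) {y : K}
    (hy : y ∉ Set.range (algebraMap F K)) :
    (y ^ Fintype.card F - y) * ∑ x : F, (y - algebraMap F K x)⁻¹ = -1 := by
  have h := sum_sub_algebraMap_pow_card_sub_one hF y
  simp_rw [sub_algebraMap_pow_card_sub_one hy, sum_add_distrib, ← mul_sum] at h
  simpa [natCast_card_eq_zero_of_algebra] using h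

theorem mul_sum_inv_sub_algebraMap_sq (hF : Odd (Fintype.card F)) {y : K}
    (hy : y ∉ Set.range (algebraMap F K)) :
    (y ^ Fintype.card F - y) ^ 2 * ∑ x : F, (y - algebraMap F K x)⁻¹ ^ 2 = 1 := by
  have h1 : 1 < Fintype.card F := Fintype.one_lt_card
  have hp (x : F) : (y - algebraMap F K x) ^ (Fintype.card F - 2) =
      (y ^ Fintype.card F - y) * (y - algebraMap F K x)⁻¹ ^ 2 + (y - algebraMap F K x)⁻¹ := by
    have h0 := sub_algebraMap_ne_zero hy x
    have h := sub_algebraMap_pow_card_sub_one hy x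
    rw [show Fintype.card F - 1 = Fintype.card F - 2 + 1 by lia, pow_succ] at h
    rw [eq_div_of_mul_eq h0 h]
    ring
  have h := sum_sub_algebraMap_pow_eq_zero (F := F) y
    (show Fintype.card F - 2 < Fintype.card F - 1 by lia)
  simp_rw [hp, sum_add_distrib, ← mul_sum] at h
  linear_combination (y ^ Fintype.card F - y) * h - mul_sum_inv_sub_algebraMap hF hy

end CarlitzSums


/-- For `q` odd, `q > 3`, `a ∈ F_q*`, `r ∈ F_{q²} \ F_q` with `r² ∈ F_q`, and
`f(x) = a·x + 1/(x - r) + 1/(x + r)`, `∑_{x ∈ F_q} f(x)² = -(1 + 4·a·r²) / (2·r²)`. -/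
theorem stmt_12 (q : ℕ) (hq : IsPrimePow q) (hodd : Odd q) (hq3 : 3 < q)
    (F K : Type*) [Field F] [Fintype F] [Field K] [Fintype K] [Algebra F K]
    (hF : Fintype.card F = q) (hK : Fintype.card K = q ^ 2)
    (a : F) (ha : a ≠ 0)
    (r : K) (hr : r ∉ Set.range (algebraMap F K))
    (hr2 : r ^ 2 ∈ Set.range (algebraMap F K)) :
    ∑ x : F, (algebraMap F K (a * x) + (algebraMap F K x - r)⁻¹
        + (algebraMap F K x + r)⁻¹) ^ 2
      = -(1 + 4 * algebraMap F K a * r ^ 2) / (2 * r ^ 2) := by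
  subst hF
  have hr' : -r ∉ Set.range (algebraMap F K) := fun ⟨x, hx⟩ => hr ⟨-x, by rw [map_neg, hx, neg_neg]⟩
  have hpow : r ^ Fintype.card F = -r := by
    obtain ⟨c, hc⟩ := hr2
    have hsq : (r ^ Fintype.card F) ^ 2 = r ^ 2 := by
      rw [← pow_mul, mul_comm, pow_mul, ← hc, ← map_pow, FiniteField.pow_card]
    refine (sq_eq_sq_iff_eq_or_eq_neg.1 hsq).resolve_left fun h => ?_
    have := mul_sum_inv_sub_algebraMap hodd hr
    rw [h, sub_self, zero_mul] at this
    exact one_ne_zero (neg_eq_zero.1 this.symm)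
  have hU := mul_sum_inv_sub_algebraMap hodd hr
  have hV := mul_sum_inv_sub_algebraMap hodd hr'
  have hU2 := mul_sum_inv_sub_algebraMap_sq hodd hr
  have hV2 := mul_sum_inv_sub_algebraMap_sq hodd hr'
  rw [hodd.neg_pow] at hV hV2
  rw [hpow] at hU hV hU2 hV2
  have hr0 : r ≠ 0 := fun h => hr ⟨0, by rw [map_zero, h]⟩
  have h2 : (2 : K) ≠ 0 := by
    intro h
    rw [show -r - r = -(2 * r) by ring, h, zero_mul, neg_zero, zero_mul] at hU
    exact one_ne_zero (neg_eq_zero.1 hU.symm)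
  have hterm (x : F) : (algebraMap F K (a * x) + (algebraMap F K x - r)⁻¹
      + (algebraMap F K x + r)⁻¹) ^ 2 =
      algebraMap F K a ^ 2 * algebraMap F K x ^ 2 + 4 * algebraMap F K a
        - (2 * algebraMap F K a * r + r⁻¹) * (r - algebraMap F K x)⁻¹
        + (2 * algebraMap F K a * r + r⁻¹) * (-r - algebraMap F K x)⁻¹
        + (r - algebraMap F K x)⁻¹ ^ 2 + (-r - algebraMap F K x)⁻¹ ^ 2 := by
    have hu := sub_algebraMap_ne_zero hr x
    have hv := sub_algebraMap_ne_zero hr' x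
    rw [← neg_sub r, show algebraMap F K x + r = -(-r - algebraMap F K x) by ring, map_mul]
    field_simp
    ring
  have hx2 : ∑ x : F, algebraMap F K x ^ 2 = 0 := by
    refine sum_algebraMap_pow_eq_zero ?_
    obtain ⟨m, hm⟩ := hodd
    lia
  simp_rw [hterm, Finset.sum_add_distrib, Finset.sum_sub_distrib, Finset.sum_add_distrib,
    ← Finset.mul_sum, hx2]
  rw [Finset.sum_const, Finset.card_univ, nsmul_eq_mul, natCast_card_eq_zero_of_algebra]
  have hD : -r - r ≠ 0 := left_ne_zero_of_mul (hU ▸ neg_ne_zero.2 one_ne_zero)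
  have hD' : - -r - -r ≠ 0 := left_ne_zero_of_mul (hV ▸ neg_ne_zero.2 one_ne_zero)
  rw [eq_div_of_mul_eq hD ((mul_comm _ _).trans hU),
    eq_div_of_mul_eq hD' ((mul_comm _ _).trans hV),
    eq_div_of_mul_eq (pow_ne_zero 2 hD) ((mul_comm _ _).trans hU2),
    eq_div_of_mul_eq (pow_ne_zero 2 hD') ((mul_comm _ _).trans hV2),
    show -r - r = -(2 * r) by ring, show - -r - -r = 2 * r by ring]
  field_simp
  ring
end
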